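/- arXiv:math/0310491 — 3 statements merged into one kernel-verified Lean document; each statement's English description precedes it below -/
import Mathlib

section
/- Let A and B be separable C*-algebras and let π = (π_t)_{t∈[1,∞)} : A → M₂(M(B)) be an equi-continuous asymptotic homomorphism whose matrix entries satisfy π^{12}_t(a) ∈ B and π^{21}_t(a) ∈ B for all t ∈ [1,∞) and a ∈ A. Then there exists a norm-continuous family (u_t)_{t∈[1,∞)} of elements of B with 0 ≤ u_t ≤ 1 and lim_{t→∞} ‖u_t x − x‖ = 0 for every x ∈ B, such that for every continuous function f : [0,1] → ℂ and every a ∈ A: lim_{t→∞} ‖f(u_t)·π^{11}_t(a) − π^{11}_t(a)·f(u_t)‖ = 0, lim_{t→∞} ‖π^{12}_t(a)·(f(u_t) − f(1)·1)‖ = 0, and lim_{t→∞} ‖π^{21}_t(a)·(f(u_t) − f(1)·1)‖ = 0, where f(u_t) is the continuous functional calculus of the self-adjoint element u_t in the unital C*-algebra M(B) and 1 is the unit of M(B). -/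
open Filter Topology

attribute [local instance] Matrix.normedAddCommGroup

/-- `φ = (φ_t)_{t ∈ [1,∞)} : A → B` is an asymptotic homomorphism. -/
def IsAsymptoticHom {A B : Type*} [Mul A] [Add A] [SMul ℂ A] [Star A]
    [SeminormedAddCommGroup B] [Mul B] [SMul ℂ B] [Star B] (φ : ℝ → A → B) : Prop :=
  (∀ a : A, ContinuousOn (fun t => φ t a) (Set.Ici 1)) ∧
  (∀ a b : A, Tendsto (fun t => ‖φ t a * φ t b - φ t (a * b)‖) atTop (𝓝 0)) ∧
  (∀ (a b : A) (c : ℂ), Tendsto (fun t => ‖φ t a + c • φ t b - φ t (a + c • b)‖) atTop (𝓝 0)) ∧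
  (∀ a : A, Tendsto (fun t => ‖star (φ t a) - φ t (star a)‖) atTop (𝓝 0))

section QuasicentralApproximateUnit

variable {M : Type*} [CStarAlgebra M] [PartialOrder M] [StarOrderedRing M]

theorem norm_le_one_of_nonneg_of_le_one {u : M} (h0 : 0 ≤ u) (h1 : u ≤ 1) : ‖u‖ ≤ 1 :=
  (CStarAlgebra.norm_le_one_iff_of_nonneg u h0).2 h1

theorem norm_one_sub_le_one {u : M} (h0 : 0 ≤ u) (h1 : u ≤ 1) : ‖1 - u‖ ≤ 1 :=
  norm_le_one_of_nonneg_of_le_one (sub_nonneg.2 h1) (sub_le_self 1 h0)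

theorem TwoSidedIdeal.smul_mem_of_algebra {R S : Type*} [CommRing R] [Ring S] [Algebra R S]
    (B : TwoSidedIdeal S) (r : R) {x : S} (hx : x ∈ B) : r • x ∈ B := by
  rw [← one_mul x, ← smul_mul_assoc]
  exact B.mul_mem_left _ _ hx

/-- A two-sided ideal contains positive contractions that are approximate right units for
finitely many of its elements. -/
theorem exists_approximate_right_unit (B : TwoSidedIdeal M) (G : Finset M)
    (hG : ∀ y ∈ G, y ∈ B) {ε : ℝ} (hε : 0 < ε) :
    ∃ e ∈ B, 0 ≤ e ∧ e ≤ 1 ∧ ∀ y ∈ G, ‖y * (1 - e)‖ ≤ ε := by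
  set h : M := ∑ y ∈ G, star y * y with hh
  have h_nonneg : 0 ≤ h := Finset.sum_nonneg fun y _ => star_mul_self_nonneg y
  have h_mem : h ∈ B := sum_mem fun y hy => B.mul_mem_left _ _ (hG y hy)
  have h_sa : IsSelfAdjoint h := .of_nonneg h_nonneg
  have hspec : ∀ s ∈ spectrum ℝ h, 0 ≤ s := fun s hs => spectrum_nonneg_of_nonneg h_nonneg hs
  set δ : ℝ := ε ^ 2 with hδ
  have δ_pos : 0 < δ := by positivity
  have hne : ∀ s ∈ spectrum ℝ h, s + δ ≠ 0 := fun s hs => by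
    have := hspec s hs; positivity
  have cont_inv : ContinuousOn (fun s : ℝ => (s + δ)⁻¹) (spectrum ℝ h) :=
    ContinuousOn.inv₀ (by fun_prop) hne
  have cont_e : ContinuousOn (fun s : ℝ => s * (s + δ)⁻¹) (spectrum ℝ h) :=
    continuousOn_id.mul cont_inv
  set e : M := cfc (fun s : ℝ => s * (s + δ)⁻¹) h with he
  have e_nonneg : 0 ≤ e := cfc_nonneg fun s hs => by
    have := hspec s hs; positivity
  have e_le : e ≤ 1 := cfc_le_one _ _ fun s hs => by
    have := hspec s hs
    rw [← div_eq_mul_inv, div_le_one (by positivity)]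
    linarith
  have one_sub_e : 1 - e = cfc (fun s : ℝ => δ * (s + δ)⁻¹) h := by
    rw [he, ← cfc_const_one ℝ h, ← cfc_sub (fun _ : ℝ => (1 : ℝ)) _ h (by fun_prop) cont_e]
    refine cfc_congr fun s hs => ?_
    have := hne s hs
    field_simp
    ring
  have cont_sub : ContinuousOn (fun s : ℝ => δ * (s + δ)⁻¹) (spectrum ℝ h) :=
    continuousOn_const.mul cont_inv
  refine ⟨e, ?_, e_nonneg, e_le, fun y hy => ?_⟩
  · have : e = h * cfc (fun s : ℝ => (s + δ)⁻¹) h := by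
      rw [he, cfc_mul (fun s : ℝ => s) _ h (by fun_prop) cont_inv, cfc_id' ℝ h]
    rw [this]
    exact B.mul_mem_right _ _ h_mem
  · have sa : star (1 - e) = 1 - e := (IsSelfAdjoint.of_nonneg (sub_nonneg.2 e_le)).star_eq
    have yh : star y * y ≤ h :=
      Finset.single_le_sum (f := fun y : M => star y * y) (fun y _ => star_mul_self_nonneg y) hy
    have conj : star (y * (1 - e)) * (y * (1 - e)) ≤ (1 - e) * h * (1 - e) := by
      have := star_left_conjugate_le_conjugate yh (1 - e)
      rw [sa] at this
      rwa [star_mul, sa, mul_assoc (1 - e), ← mul_assoc (star y), ← mul_assoc (1 - e)]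
    have bound : ‖(1 - e) * h * (1 - e)‖ ≤ δ := by
      have : (1 - e) * h * (1 - e)
          = cfc (fun s : ℝ => δ * (s + δ)⁻¹ * s * (δ * (s + δ)⁻¹)) h := by
        rw [cfc_mul (fun s : ℝ => δ * (s + δ)⁻¹ * s) _ h (cont_sub.mul continuousOn_id) cont_sub,
          cfc_mul _ (fun s : ℝ => s) h cont_sub (by fun_prop), cfc_id' ℝ h, one_sub_e]
      rw [this]
      refine norm_cfc_le δ_pos.le fun s hs => ?_
      have hs0 := hspec s hs
      rw [Real.norm_of_nonneg (by positivity)]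
      have : δ * (s + δ)⁻¹ * s * (δ * (s + δ)⁻¹) = δ * (δ * s / (s + δ) ^ 2) := by
        field_simp
      rw [this]
      refine mul_le_of_le_one_right δ_pos.le ?_
      rw [div_le_one (by positivity)]
      nlinarith
    have := (CStarAlgebra.norm_le_norm_of_nonneg_of_le (star_mul_self_nonneg _) conj).trans bound
    rw [CStarRing.norm_star_mul_self, hδ, ← sq] at this
    exact le_of_sq_le_sq this hε.le

/-- Sums of `n` successive approximate units of an ideal: the commutators with given elements grow
in norm only like `√n`. -/
theorem exists_sum_approximate_units (B : TwoSidedIdeal M) (F G : Finset M)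
    (hG : ∀ y ∈ G, y ∈ B) {ε : ℝ} (hε : 0 < ε) (n : ℕ) :
    ∃ s ∈ B, 0 ≤ s ∧ s ≤ (n : M) ∧ (∀ y ∈ G, ‖y * (n - s)‖ ≤ n * ε) ∧
      ∃ S : M → M, (∀ x, s * x - x * s = S x - star (S (star x))) ∧
        ∀ x ∈ F, S x ∈ B ∧ ‖S x‖ ^ 2 ≤ n * (‖x‖ + 1) ^ 2 := by
  classical
  induction n with
  | zero =>
    exact ⟨0, B.zero_mem, le_rfl, by simp, by simp, fun _ => 0, by simp,
      fun x _ => ⟨B.zero_mem, by simp⟩⟩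
  | succ n ih =>
    obtain ⟨s, hsB, hs0, hsn, hsG, S, hS, hSF⟩ := ih
    obtain ⟨e, heB, he0, he1, he⟩ := exists_approximate_right_unit B (G ∪ F.image S) (by
      intro y hy
      rcases Finset.mem_union.1 hy with h | h
      · exact hG y h
      · obtain ⟨x, hx, rfl⟩ := Finset.mem_image.1 h
        exact (hSF x hx).1) (lt_min hε one_pos)
    have sa : star e = e := (IsSelfAdjoint.of_nonneg he0).star_eq
    have ne : ‖e‖ ≤ 1 := norm_le_one_of_nonneg_of_le_one he0 he1
    have ne' : ‖1 - e‖ ≤ 1 := norm_one_sub_le_one he0 he1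
    refine ⟨s + e, B.add_mem hsB heB, add_nonneg hs0 he0, ?_, fun y hy => ?_,
      fun x => S x + e * x * (1 - e), fun x => ?_, fun x hx => ⟨?_, ?_⟩⟩
    · push_cast
      exact add_le_add hsn he1
    · have h1 := hsG y hy
      have h2 := (he y (Finset.mem_union_left _ hy)).trans (min_le_left _ _)
      have : y * (((n + 1 : ℕ) : M) - (s + e)) = y * (n - s) + y * (1 - e) := by
        push_cast; noncomm_ring
      rw [this]
      refine (norm_add_le _ _).trans ?_
      push_cast
      linarith
    · have h1 := hS x
      have : (s + e) * x - x * (s + e) = (s * x - x * s) + (e * x - x * e) := by noncomm_ring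
      rw [this, h1]
      simp only [star_add, star_mul, star_sub, star_one, star_star, sa]
      noncomm_ring
    · exact B.add_mem (hSF x hx).1 (B.mul_mem_right _ _ (B.mul_mem_right _ _ heB))
    · have h1 := (hSF x hx).2
      have h2 : ‖S x * (1 - e)‖ ≤ 1 :=
        (he (S x) (Finset.mem_union_right _ (Finset.mem_image_of_mem S hx))).trans (min_le_right _ _)
      set c := e * x * (1 - e) with hc
      have nc : ‖c‖ ≤ ‖x‖ := calc
        ‖c‖ ≤ ‖e‖ * ‖x‖ * ‖1 - e‖ := norm_mul₃_le
        _ ≤ 1 * ‖x‖ * 1 := by gcongr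
        _ = ‖x‖ := by ring
      have cross : ‖S x * star c‖ ≤ ‖x‖ := by
        have : S x * star c = S x * (1 - e) * star x * e := by
          simp only [hc, star_mul, star_sub, star_one, sa, mul_assoc]
        rw [this]
        calc _ ≤ ‖S x * (1 - e)‖ * ‖star x‖ * ‖e‖ := norm_mul₃_le
          _ ≤ 1 * ‖star x‖ * 1 := by gcongr
          _ = ‖x‖ := by rw [norm_star]; ring
      have cross' : ‖c * star (S x)‖ ≤ ‖x‖ := by
        rw [← norm_star, star_mul, star_star]; exact cross
      have expand : (S x + c) * star (S x + c)
          = S x * star (S x) + S x * star c + c * star (S x) + c * star c := by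
        rw [star_add]; noncomm_ring
      have key : ‖S x + c‖ ^ 2 ≤ ‖S x‖ ^ 2 + ‖x‖ + ‖x‖ + ‖c‖ ^ 2 := by
        rw [sq, ← CStarRing.norm_self_mul_star, expand, sq, sq, ← CStarRing.norm_self_mul_star,
          ← CStarRing.norm_self_mul_star (x := c)]
        exact norm_add₄_le.trans (by gcongr)
      have : ‖c‖ ^ 2 ≤ ‖x‖ ^ 2 := by gcongr
      push_cast
      nlinarith

/-- A two-sided ideal contains positive contractions that are approximate right units for finitely
many of its elements and almost commute with finitely many elements of the ambient algebra. -/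
theorem exists_quasicentral_of_finset (B : TwoSidedIdeal M) (F G : Finset M)
    (hG : ∀ y ∈ G, y ∈ B) {ε : ℝ} (hε : 0 < ε) :
    ∃ w ∈ B, 0 ≤ w ∧ w ≤ 1 ∧ (∀ x ∈ F, ‖w * x - x * w‖ ≤ ε) ∧ ∀ y ∈ G, ‖y * (w - 1)‖ ≤ ε := by
  classical
  obtain ⟨m, hm⟩ := exists_nat_gt (2 * (∑ x ∈ F, ‖x‖ + 1) / ε)
  have sum_nonneg : 0 ≤ ∑ x ∈ F, ‖x‖ := Finset.sum_nonneg fun x _ => norm_nonneg x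
  have m_pos : (0 : ℝ) < m := lt_of_le_of_lt (by positivity) hm
  obtain ⟨s, hsB, hs0, hsn, hsG, S, hS, hSF⟩ :=
    exists_sum_approximate_units B (F ∪ F.image star) G hG hε (m ^ 2)
  push_cast at hsn hsG hSF
  have hS_norm : ∀ x ∈ F ∪ F.image star, ‖S x‖ ≤ m * (‖x‖ + 1) := fun x hx => by
    have := (hSF x hx).2
    rw [← mul_pow] at this
    exact le_of_sq_le_sq this (by positivity)
  have inv_smul : ((m : ℝ) ^ 2)⁻¹ • ((m : M) ^ 2) = 1 := by
    have : (m : M) ^ 2 = ((m : ℝ) ^ 2) • (1 : M) := by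
      rw [← Algebra.algebraMap_eq_smul_one]; simp
    rw [this, inv_smul_smul₀ (by positivity)]
  have r_nonneg : 0 ≤ ((m : ℝ) ^ 2)⁻¹ := by positivity
  refine ⟨((m : ℝ) ^ 2)⁻¹ • s, B.smul_mem_of_algebra _ hsB, smul_nonneg r_nonneg hs0, ?_,
    fun x hx => ?_, fun y hy => ?_⟩
  · rw [← inv_smul]
    exact smul_le_smul_of_nonneg_left hsn r_nonneg
  · rw [smul_mul_assoc, mul_smul_comm, ← smul_sub, hS, norm_smul, Real.norm_of_nonneg r_nonneg]
    have h1 := hS_norm x (Finset.mem_union_left _ hx)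
    have h2 := hS_norm (star x) (Finset.mem_union_right _ (Finset.mem_image_of_mem star hx))
    rw [norm_star] at h2
    have h3 : ‖S x - star (S (star x))‖ ≤ 2 * m * (‖x‖ + 1) := by
      refine (norm_sub_le _ _).trans ?_
      rw [norm_star]
      linarith
    have h4 : ‖x‖ ≤ ∑ x ∈ F, ‖x‖ :=
      Finset.single_le_sum (f := fun x : M => ‖x‖) (fun x _ => norm_nonneg x) hx
    rw [div_lt_iff₀ hε] at hm
    rw [inv_mul_le_iff₀ (by positivity)]
    nlinarith
  · have : y * (((m : ℝ) ^ 2)⁻¹ • s - 1) = -(((m : ℝ) ^ 2)⁻¹ • (y * ((m : M) ^ 2 - s))) := by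
      rw [mul_sub, mul_sub, smul_sub, ← mul_smul_comm, ← mul_smul_comm, inv_smul]; abel
    rw [this, norm_neg, norm_smul, Real.norm_of_nonneg r_nonneg, inv_mul_le_iff₀ (by positivity)]
    exact hsG y hy

theorem exists_quasicentral_of_isCompact (B : TwoSidedIdeal M) {K L : Set M} (hK : IsCompact K)
    (hL : IsCompact L) (hLB : ∀ y ∈ L, y ∈ B) {ε : ℝ} (hε : 0 < ε) :
    ∃ w ∈ B, 0 ≤ w ∧ w ≤ 1 ∧ (∀ x ∈ K, ‖w * x - x * w‖ ≤ ε) ∧ ∀ y ∈ L, ‖y * (w - 1)‖ ≤ ε := by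
  have hε3 : 0 < ε / 3 := by positivity
  obtain ⟨F, -, hFfin, hF⟩ := hK.finite_cover_balls hε3
  obtain ⟨G, hGL, hGfin, hG⟩ := hL.finite_cover_balls hε3
  obtain ⟨w, hwB, hw0, hw1, hwF, hwG⟩ := exists_quasicentral_of_finset B hFfin.toFinset
    hGfin.toFinset (fun y hy => hLB y (hGL (hGfin.mem_toFinset.1 hy))) hε3
  have nw := norm_le_one_of_nonneg_of_le_one hw0 hw1
  have nw' : ‖w - 1‖ ≤ 1 := by rw [norm_sub_rev]; exact norm_one_sub_le_one hw0 hw1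
  refine ⟨w, hwB, hw0, hw1, fun x hx => ?_, fun y hy => ?_⟩
  · obtain ⟨z, hz, hxz⟩ := Set.mem_iUnion₂.1 (hF hx)
    rw [mem_ball_iff_norm] at hxz
    have h1 := hwF z (hFfin.mem_toFinset.2 hz)
    have : w * x - x * w = (w * z - z * w) + w * (x - z) - (x - z) * w := by noncomm_ring
    rw [this]
    have h2 : ‖w * (x - z)‖ ≤ 1 * ‖x - z‖ := (norm_mul_le _ _).trans (by gcongr)
    have h3 : ‖(x - z) * w‖ ≤ ‖x - z‖ * 1 := (norm_mul_le _ _).trans (by gcongr)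
    linarith [norm_sub_le (w * z - z * w + w * (x - z)) ((x - z) * w),
      norm_add_le (w * z - z * w) (w * (x - z))]
  · obtain ⟨z, hz, hyz⟩ := Set.mem_iUnion₂.1 (hG hy)
    rw [mem_ball_iff_norm] at hyz
    have h1 := hwG z (hGfin.mem_toFinset.2 hz)
    have : y * (w - 1) = z * (w - 1) + (y - z) * (w - 1) := by noncomm_ring
    rw [this]
    have h3 : ‖(y - z) * (w - 1)‖ ≤ ‖y - z‖ * 1 := (norm_mul_le _ _).trans (by gcongr)
    linarith [norm_add_le (z * (w - 1)) ((y - z) * (w - 1))]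

end QuasicentralApproximateUnit

section FunctionalCalculus

open Polynomial

theorem exists_complex_polynomial_near {f : ℂ → ℂ} (hf : Continuous f) {ε : ℝ} (hε : 0 < ε) :
    ∃ p : ℂ[X], ∀ s ∈ Set.Icc (0 : ℝ) 1, ‖f s - p.eval (s : ℂ)‖ ≤ ε := by
  obtain ⟨P, hP⟩ := exists_polynomial_near_of_continuousOn 0 1 (fun s => (f s).re)
    (by fun_prop) (ε / 2) (by positivity)
  obtain ⟨Q, hQ⟩ := exists_polynomial_near_of_continuousOn 0 1 (fun s => (f s).im)
    (by fun_prop) (ε / 2) (by positivity)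
  refine ⟨P.map (algebraMap ℝ ℂ) + C Complex.I * Q.map (algebraMap ℝ ℂ), fun s hs => ?_⟩
  have evalP : (P.map (algebraMap ℝ ℂ)).eval (s : ℂ) = ((P.eval s : ℝ) : ℂ) :=
    eval_map_algebraMap P (s : ℂ) ▸ aeval_algebraMap_apply_eq_algebraMap_eval s P
  have evalQ : (Q.map (algebraMap ℝ ℂ)).eval (s : ℂ) = ((Q.eval s : ℝ) : ℂ) :=
    eval_map_algebraMap Q (s : ℂ) ▸ aeval_algebraMap_apply_eq_algebraMap_eval s Q
  rw [eval_add, eval_mul, eval_C, evalP, evalQ]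
  refine (Complex.norm_le_abs_re_add_abs_im _).trans ?_
  have h1 := hP s hs
  have h2 := hQ s hs
  rw [abs_sub_comm] at h1 h2
  simp only [Complex.sub_re, Complex.sub_im, Complex.add_re, Complex.add_im, Complex.mul_re,
    Complex.mul_im, Complex.ofReal_re, Complex.ofReal_im, Complex.I_re, Complex.I_im, zero_mul,
    one_mul, mul_zero, sub_zero, add_zero, zero_add]
  linarith

variable {M : Type*} [CStarAlgebra M]

theorem exists_norm_commutator_aeval_le (p : ℂ[X]) :
    ∃ C : ℝ, 0 ≤ C ∧ ∀ u : M, ‖u‖ ≤ 1 → ∀ q : M,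
      ‖aeval u p * q - q * aeval u p‖ ≤ C * ‖u * q - q * u‖ := by
  induction p using Polynomial.induction_on' with
  | add p₁ p₂ h₁ h₂ =>
    obtain ⟨C₁, hC₁, h₁⟩ := h₁
    obtain ⟨C₂, hC₂, h₂⟩ := h₂
    refine ⟨C₁ + C₂, by positivity, fun u hu q => ?_⟩
    have : aeval u (p₁ + p₂) * q - q * aeval u (p₁ + p₂)
        = (aeval u p₁ * q - q * aeval u p₁) + (aeval u p₂ * q - q * aeval u p₂) := by
      rw [map_add]; noncomm_ring
    rw [this, add_mul]
    exact (norm_add_le _ _).trans (add_le_add (h₁ u hu q) (h₂ u hu q))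
  | monomial n c =>
    refine ⟨‖c‖ * n, by positivity, fun u hu q => ?_⟩
    have pow : ‖u ^ n * q - q * u ^ n‖ ≤ n * ‖u * q - q * u‖ := by
      induction n with
      | zero => simp
      | succ n ih =>
        have : u ^ (n + 1) * q - q * u ^ (n + 1)
            = u ^ n * (u * q - q * u) + (u ^ n * q - q * u ^ n) * u := by
          rw [pow_succ]; noncomm_ring
        rw [this]
        have h₁ : ‖u ^ n * (u * q - q * u)‖ ≤ ‖u * q - q * u‖ := by
          rcases n.eq_zero_or_pos with rfl | hn
          · simp
          · calc _ ≤ ‖u ^ n‖ * ‖u * q - q * u‖ := norm_mul_le _ _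
              _ ≤ 1 * ‖u * q - q * u‖ := by
                gcongr
                exact (norm_pow_le' u hn).trans (pow_le_one₀ (norm_nonneg _) hu)
              _ = _ := one_mul _
        have h₂ : ‖(u ^ n * q - q * u ^ n) * u‖ ≤ n * ‖u * q - q * u‖ * 1 :=
          (norm_mul_le _ _).trans (by gcongr)
        push_cast
        linarith [norm_add_le (u ^ n * (u * q - q * u)) ((u ^ n * q - q * u ^ n) * u)]
    rw [aeval_monomial, ← Algebra.smul_def, smul_mul_assoc, mul_smul_comm, ← smul_sub, norm_smul,
      mul_assoc]
    gcongr

theorem exists_norm_mul_aeval_sub_le (p : ℂ[X]) :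
    ∃ C : ℝ, 0 ≤ C ∧ ∀ u : M, ‖u‖ ≤ 1 → ∀ y : M,
      ‖y * (aeval u p - p.eval 1 • (1 : M))‖ ≤ C * ‖y * (u - 1)‖ := by
  induction p using Polynomial.induction_on' with
  | add p₁ p₂ h₁ h₂ =>
    obtain ⟨C₁, hC₁, h₁⟩ := h₁
    obtain ⟨C₂, hC₂, h₂⟩ := h₂
    refine ⟨C₁ + C₂, by positivity, fun u hu y => ?_⟩
    have : y * (aeval u (p₁ + p₂) - (p₁ + p₂).eval 1 • (1 : M))
        = y * (aeval u p₁ - p₁.eval 1 • (1 : M)) + y * (aeval u p₂ - p₂.eval 1 • (1 : M)) := by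
      rw [map_add, eval_add, add_smul]; noncomm_ring
    rw [this, add_mul]
    exact (norm_add_le _ _).trans (add_le_add (h₁ u hu y) (h₂ u hu y))
  | monomial n c =>
    refine ⟨‖c‖ * n, by positivity, fun u hu y => ?_⟩
    have pow : ‖y * (u ^ n - 1)‖ ≤ n * ‖y * (u - 1)‖ := by
      induction n with
      | zero => simp
      | succ n ih =>
        have : y * (u ^ (n + 1) - 1) = y * (u ^ n - 1) * u + y * (u - 1) := by
          rw [pow_succ]; noncomm_ring
        rw [this]
        have h₂ : ‖y * (u ^ n - 1) * u‖ ≤ n * ‖y * (u - 1)‖ * 1 :=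
          (norm_mul_le _ _).trans (by gcongr)
        push_cast
        linarith [norm_add_le (y * (u ^ n - 1) * u) (y * (u - 1))]
    rw [aeval_monomial, ← Algebra.smul_def, eval_monomial, one_pow, mul_one, ← smul_sub,
      mul_smul_comm, norm_smul, mul_assoc]
    gcongr

variable [PartialOrder M] [StarOrderedRing M]

theorem exists_mem_Icc_of_mem_spectrum {u : M} (h0 : 0 ≤ u) (h1 : u ≤ 1) {z : ℂ}
    (hz : z ∈ spectrum ℂ u) : ∃ s ∈ Set.Icc (0 : ℝ) 1, (s : ℂ) = z := by
  have hu : IsSelfAdjoint u := .of_nonneg h0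
  have hre : z = (z.re : ℂ) := hu.mem_spectrum_eq_re hz
  have hmem : z.re ∈ spectrum ℝ u := by
    rw [hre] at hz
    exact spectrum.of_algebraMap_mem ℂ hz
  refine ⟨z.re, ⟨spectrum_nonneg_of_nonneg h0 hmem, ?_⟩, hre.symm⟩
  have := (cfc_le_one_iff (id : ℝ → ℝ) u).1 (by rwa [cfc_id ℝ u])
  exact this _ hmem

/-- The continuous functional calculus is approximated by polynomials, uniformly over all positive
contractions. -/
theorem exists_polynomial_norm_cfc_sub_le {f : ℂ → ℂ} (hf : Continuous f) {ε : ℝ} (hε : 0 < ε) :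
    ∃ p : ℂ[X], ‖f 1 - p.eval 1‖ ≤ ε ∧
      ∀ u : M, 0 ≤ u → u ≤ 1 → ‖cfc f u - aeval u p‖ ≤ ε := by
  obtain ⟨p, hp⟩ := exists_complex_polynomial_near hf hε
  refine ⟨p, by simpa using hp 1 (by simp), fun u h0 h1 => ?_⟩
  have hu : IsStarNormal u := (IsSelfAdjoint.of_nonneg h0).isStarNormal
  rw [← cfc_polynomial p u, ← cfc_sub f _ u (by fun_prop) (by fun_prop)]
  refine norm_cfc_le hε.le fun z hz => ?_
  obtain ⟨s, hs, rfl⟩ := exists_mem_Icc_of_mem_spectrum h0 h1 hz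
  exact hp s hs

theorem tendsto_norm_commutator_cfc {f : ℂ → ℂ} (hf : Continuous f) {u q : ℝ → M}
    (hu : ∀ᶠ t in atTop, 0 ≤ u t ∧ u t ≤ 1) {R : ℝ} (hq : ∀ᶠ t in atTop, ‖q t‖ ≤ R)
    (h : Tendsto (fun t => u t * q t - q t * u t) atTop (𝓝 0)) :
    Tendsto (fun t => ‖cfc f (u t) * q t - q t * cfc f (u t)‖) atTop (𝓝 0) := by
  rw [Metric.tendsto_nhds]
  intro ε hε
  obtain ⟨p, -, hp⟩ := exists_polynomial_norm_cfc_sub_le (M := M) hf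
    (ε := ε / (4 * (|R| + 1))) (by positivity)
  obtain ⟨C, hC, hCp⟩ := exists_norm_commutator_aeval_le (M := M) p
  have hsmall := h.norm.eventually_lt_const (u := ε / (2 * (C + 1))) (by rw [norm_zero]; positivity)
  filter_upwards [hu, hq, hsmall] with t ht hqt hst
  rw [Real.dist_0_eq_abs, abs_norm]
  have h₁ := hCp (u t) (norm_le_one_of_nonneg_of_le_one ht.1 ht.2) (q t)
  have h₂ := hp (u t) ht.1 ht.2
  set d := cfc f (u t) - aeval (u t) p with hd
  have : cfc f (u t) * q t - q t * cfc f (u t)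
      = (aeval (u t) p * q t - q t * aeval (u t) p) + (d * q t - q t * d) := by
    rw [hd]; noncomm_ring
  rw [this]
  have h₃ : ‖d * q t - q t * d‖ ≤ ε / 2 := by
    have : ‖d‖ * ‖q t‖ ≤ ε / 4 := calc
      _ ≤ ε / (4 * (|R| + 1)) * (|R| + 1) := by
        gcongr; linarith [le_abs_self R]
      _ = ε / 4 := by field_simp
    linarith [norm_sub_le (d * q t) (q t * d), norm_mul_le d (q t), norm_mul_le (q t) d]
  have h₄ : C * ‖u t * q t - q t * u t‖ < ε / 2 := by
    rw [lt_div_iff₀ (by positivity)] at hst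
    nlinarith [norm_nonneg (u t * q t - q t * u t)]
  linarith [norm_add_le (aeval (u t) p * q t - q t * aeval (u t) p) (d * q t - q t * d)]

theorem tendsto_norm_mul_cfc_sub {f : ℂ → ℂ} (hf : Continuous f) {u y : ℝ → M}
    (hu : ∀ᶠ t in atTop, 0 ≤ u t ∧ u t ≤ 1) {R : ℝ} (hy : ∀ᶠ t in atTop, ‖y t‖ ≤ R)
    (h : Tendsto (fun t => y t * (u t - 1)) atTop (𝓝 0)) :
    Tendsto (fun t => ‖y t * (cfc f (u t) - f 1 • (1 : M))‖) atTop (𝓝 0) := by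
  rw [Metric.tendsto_nhds]
  intro ε hε
  obtain ⟨p, hp1, hp⟩ := exists_polynomial_norm_cfc_sub_le (M := M) hf
    (ε := ε / (4 * (|R| + 1))) (by positivity)
  obtain ⟨C, hC, hCp⟩ := exists_norm_mul_aeval_sub_le (M := M) p
  have hsmall := h.norm.eventually_lt_const (u := ε / (2 * (C + 1))) (by rw [norm_zero]; positivity)
  filter_upwards [hu, hy, hsmall] with t ht hyt hst
  rw [Real.dist_0_eq_abs, abs_norm]
  have h₁ := hCp (u t) (norm_le_one_of_nonneg_of_le_one ht.1 ht.2) (y t)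
  have h₂ := hp (u t) ht.1 ht.2
  set d := cfc f (u t) - aeval (u t) p with hd
  have : y t * (cfc f (u t) - f 1 • (1 : M))
      = y t * (aeval (u t) p - p.eval 1 • (1 : M)) + (y t * d - (f 1 - p.eval 1) • y t) := by
    rw [hd, mul_sub, mul_sub, mul_sub, mul_smul_comm, mul_smul_comm, mul_one, sub_smul]; abel
  rw [this]
  have h₃ : ‖y t * d - (f 1 - p.eval 1) • y t‖ ≤ ε / 2 := by
    have bound : ∀ r : ℝ, r ≤ ε / (4 * (|R| + 1)) → r * ‖y t‖ ≤ ε / 4 := fun r hr => calc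
      _ ≤ ε / (4 * (|R| + 1)) * (|R| + 1) := by
        gcongr; linarith [le_abs_self R]
      _ = ε / 4 := by field_simp
    have := norm_smul_le (f 1 - p.eval 1) (y t)
    linarith [norm_sub_le (y t * d) ((f 1 - p.eval 1) • y t), norm_mul_le (y t) d,
      bound _ h₂, bound _ hp1]
  have h₄ : C * ‖y t * (u t - 1)‖ < ε / 2 := by
    rw [lt_div_iff₀ (by positivity)] at hst
    nlinarith [norm_nonneg (y t * (u t - 1))]
  linarith [norm_add_le (y t * (aeval (u t) p - p.eval 1 • (1 : M)))
    (y t * d - (f 1 - p.eval 1) • y t)]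

end FunctionalCalculus

section Equicontinuity

/-- For a family that is equicontinuous on `[1,∞)`, convergence to zero at infinity propagates from
a dense set of points to all points. -/
theorem tendsto_zero_of_denseRange {X E : Type*} [TopologicalSpace X] [SeminormedAddCommGroup E]
    {ψ : ℝ → X → E}
    (hψ : ∀ a, ∀ ε > 0, ∀ᶠ a' in 𝓝 a, ∀ t : ℝ, 1 ≤ t → ‖ψ t a - ψ t a'‖ ≤ ε)
    {d : ℕ → X} (hd : DenseRange d) (h : ∀ k, Tendsto (fun t => ψ t (d k)) atTop (𝓝 0)) (a : X) :
    Tendsto (fun t => ψ t a) atTop (𝓝 0) := by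
  rw [Metric.tendsto_nhds]
  intro ε hε
  obtain ⟨_, ha', k, rfl⟩ := mem_closure_iff_nhds.1 (hd a) _ (hψ a (ε / 2) (by positivity))
  filter_upwards [eventually_ge_atTop 1, Metric.tendsto_nhds.1 (h k) (ε / 2) (by positivity)]
    with t ht hk
  rw [dist_zero_right] at hk ⊢
  have := norm_add_le (ψ t a - ψ t (d k)) (ψ t (d k))
  rw [sub_add_cancel] at this
  linarith [ha' t ht]

/-- A family on a connected space that is equicontinuous on `[1,∞)` and converges to zero at one
point is eventually bounded at every point. -/
theorem exists_eventually_norm_le {X E : Type*} [TopologicalSpace X] [PreconnectedSpace X]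
    [SeminormedAddCommGroup E] {ψ : ℝ → X → E}
    (hψ : ∀ a, ∀ ε > 0, ∀ᶠ a' in 𝓝 a, ∀ t : ℝ, 1 ≤ t → ‖ψ t a - ψ t a'‖ ≤ ε)
    {x₀ : X} (h : Tendsto (fun t => ψ t x₀) atTop (𝓝 0)) (a : X) :
    ∃ R : ℝ, ∀ᶠ t in atTop, ‖ψ t a‖ ≤ R := by
  set S : Set X := {a | ∃ R : ℝ, ∀ᶠ t in atTop, ‖ψ t a‖ ≤ R} with hS
  have step : ∀ a, ∀ᶠ a' in 𝓝 a, a ∈ S ↔ a' ∈ S := fun a => by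
    filter_upwards [hψ a 1 one_pos] with a' ha'
    constructor
    · rintro ⟨R, hR⟩
      refine ⟨R + 1, ?_⟩
      filter_upwards [hR, eventually_ge_atTop 1] with t ht h1
      linarith [ha' t h1, norm_le_norm_add_norm_sub (ψ t a) (ψ t a')]
    · rintro ⟨R, hR⟩
      refine ⟨R + 1, ?_⟩
      filter_upwards [hR, eventually_ge_atTop 1] with t ht h1
      linarith [ha' t h1, norm_le_norm_add_norm_sub' (ψ t a) (ψ t a')]
  have clopen : IsClopen S := by
    refine ⟨⟨isOpen_iff_mem_nhds.2 fun a ha => ?_⟩, isOpen_iff_mem_nhds.2 fun a ha => ?_⟩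
    · filter_upwards [step a] with a' h' ha'
      exact ha (h'.2 ha')
    · filter_upwards [step a] with a' h'
      exact h'.1 ha
  have hx₀ : x₀ ∈ S := ⟨1, (h.norm.eventually_le_const (by simp)).mono fun _ => id⟩
  have : a ∈ S := by rw [clopen.eq_univ ⟨x₀, hx₀⟩]; trivial
  exact this

end Equicontinuity
section ContinuousApproximateUnit

variable {M : Type*} [CStarAlgebra M] [PartialOrder M] [StarOrderedRing M]

/-- A continuous family of positive contractions of an ideal which asymptotically commutes with
countably many continuous paths `x k` in the ambient algebra and asymptotically acts as a right unit
on countably many continuous paths `y k` in the ideal. -/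
theorem exists_continuous_quasicentral (B : TwoSidedIdeal M) (x y : ℕ → ℝ → M)
    (hx : ∀ k, ContinuousOn (x k) (Set.Ici 1)) (hy : ∀ k, ContinuousOn (y k) (Set.Ici 1))
    (hyB : ∀ k, ∀ t ∈ Set.Ici (1 : ℝ), y k t ∈ B) :
    ∃ u : ℝ → M, Continuous u ∧ (∀ t, u t ∈ B ∧ 0 ≤ u t ∧ u t ≤ 1) ∧
      (∀ k, Tendsto (fun t => u t * x k t - x k t * u t) atTop (𝓝 0)) ∧
      ∀ k, Tendsto (fun t => y k t * (u t - 1)) atTop (𝓝 0) := by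
  let T : ℝ → Set M := fun t => {w | (w ∈ B ∧ 0 ≤ w ∧ w ≤ 1) ∧ (1 ≤ t → ∀ k : ℕ, (k : ℝ) ≤ t →
    ‖w * x k t - x k t * w‖ ≤ 1 / t ∧ ‖y k t * (w - 1)‖ ≤ 1 / t)}
  have norm_combo {r a b : ℝ} {v w : M} (hv : ‖v‖ ≤ r) (hw : ‖w‖ ≤ r) (ha : 0 ≤ a) (hb : 0 ≤ b)
      (hab : a + b = 1) : ‖a • v + b • w‖ ≤ r :=
    mem_closedBall_zero_iff.1 <| convex_closedBall (0 : M) r (mem_closedBall_zero_iff.2 hv)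
      (mem_closedBall_zero_iff.2 hw) ha hb hab
  have T_convex : ∀ t, Convex ℝ (T t) := by
    rintro t v ⟨⟨hvB, hv⟩, hvt⟩ w ⟨⟨hwB, hw⟩, hwt⟩ a b ha hb hab
    refine ⟨⟨B.add_mem (B.smul_mem_of_algebra a hvB) (B.smul_mem_of_algebra b hwB),
      convex_Icc (0 : M) 1 hv hw ha hb hab⟩, fun ht k hk => ⟨?_, ?_⟩⟩
    · convert norm_combo (hvt ht k hk).1 (hwt ht k hk).1 ha hb hab using 2
      simp only [add_mul, mul_add, smul_mul_assoc, mul_smul_comm, smul_sub]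
      abel
    · convert norm_combo (hvt ht k hk).2 (hwt ht k hk).2 ha hb hab using 2
      have : y k t = a • y k t + b • y k t := by rw [← add_smul, hab, one_smul]
      simp only [mul_sub, mul_add, mul_smul_comm, smul_sub, mul_one]
      nth_rewrite 3 [this]
      abel
  have T_local : ∀ t₀ : ℝ, ∃ w : M, ∀ᶠ t in 𝓝 t₀, w ∈ T t := by
    intro t₀
    obtain ⟨n, hn⟩ := exists_nat_gt (max t₀ 1)
    have n_pos : (0 : ℝ) < n := one_pos.trans (lt_of_le_of_lt (le_max_right _ _) hn)
    have compact : ∀ z : ℕ → ℝ → M, (∀ k, ContinuousOn (z k) (Set.Ici 1)) →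
        IsCompact (⋃ k ∈ Set.Iic n, z k '' Set.Icc (1 : ℝ) n) := fun z hz =>
      (Set.finite_Iic n).isCompact_biUnion fun k _ =>
        isCompact_Icc.image_of_continuousOn ((hz k).mono Set.Icc_subset_Ici_self)
    obtain ⟨w, hwB, hw0, hw1, hwx, hwy⟩ := exists_quasicentral_of_isCompact B (compact x hx)
      (compact y hy) (by
        intro v hv
        obtain ⟨k, -, t, ht, rfl⟩ := Set.mem_iUnion₂.1 hv
        exact hyB k t ht.1) (one_div_pos.2 n_pos)
    refine ⟨w, ?_⟩
    filter_upwards [eventually_lt_nhds (lt_of_le_of_lt (le_max_left _ _) hn)] with t htn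
    refine ⟨⟨hwB, hw0, hw1⟩, fun ht k hk => ?_⟩
    have mem : ∀ z : ℕ → ℝ → M, z k t ∈ ⋃ k ∈ Set.Iic n, z k '' Set.Icc (1 : ℝ) n := fun z =>
      Set.mem_biUnion (x := k) (by exact_mod_cast hk.trans htn.le) ⟨t, ⟨ht, htn.le⟩, rfl⟩
    have le : 1 / (n : ℝ) ≤ 1 / t := one_div_le_one_div_of_le (by linarith) htn.le
    exact ⟨(hwx _ (mem x)).trans le, (hwy _ (mem y)).trans le⟩
  obtain ⟨u, hu⟩ := exists_continuous_forall_mem_convex_of_local_const T_convex T_local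
  have inv_lim : Tendsto (fun t : ℝ => 1 / t) atTop (𝓝 0) := by
    simpa only [one_div] using tendsto_inv_atTop_zero
  refine ⟨u, u.continuous, fun t => (hu t).1, fun k => ?_, fun k => ?_⟩
  · refine squeeze_zero_norm' ?_ inv_lim
    filter_upwards [eventually_ge_atTop 1, eventually_ge_atTop (k : ℝ)] with t h1 hk
    exact ((hu t).2 h1 k hk).1
  · refine squeeze_zero_norm' ?_ inv_lim
    filter_upwards [eventually_ge_atTop 1, eventually_ge_atTop (k : ℝ)] with t h1 hk
    exact ((hu t).2 h1 k hk).2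

end ContinuousApproximateUnit

/-- Existence of an approximate unit `(u_t)` of `B` which asymptotically commutes with the
`(1,1)`-entry of `π` and asymptotically acts as the scalar `f(1)` on the off-diagonal entries,
for every continuous function `f` on `[0,1]`.  Here `M(B)` is modelled as a unital C*-algebra
`MB` containing `B` as a closed two-sided ideal, and `f(u_t)` is the continuous functional
calculus in `MB`. -/
theorem statement12 {A MB : Type*} [NonUnitalCStarAlgebra A]
    [CStarAlgebra MB] [PartialOrder MB] [StarOrderedRing MB]
    (hA_sep : TopologicalSpace.SeparableSpace A)
    (B : TwoSidedIdeal MB) (hB : IsClosed (B : Set MB))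
    (hB_sep : TopologicalSpace.SeparableSpace (B : Set MB))
    (π : ℝ → A → Matrix (Fin 2) (Fin 2) MB)
    (hπ : IsAsymptoticHom π)
    (hπ_equi : Equicontinuous (fun t : Set.Ici (1 : ℝ) => π t))
    (hπ_off : ∀ t ∈ Set.Ici (1 : ℝ), ∀ a : A, π t a 0 1 ∈ B ∧ π t a 1 0 ∈ B) :
    ∃ u : ℝ → MB,
      ContinuousOn u (Set.Ici 1) ∧
      (∀ t ∈ Set.Ici (1 : ℝ), u t ∈ B ∧ 0 ≤ u t ∧ u t ≤ 1) ∧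
      (∀ x ∈ B, Tendsto (fun t => ‖u t * x - x‖) atTop (𝓝 0)) ∧
      (∀ f : ℂ → ℂ, Continuous f → ∀ a : A,
        Tendsto (fun t => ‖cfc f (u t) * π t a 0 0 - π t a 0 0 * cfc f (u t)‖) atTop (𝓝 0) ∧
        Tendsto (fun t => ‖π t a 0 1 * (cfc f (u t) - f 1 • (1 : MB))‖) atTop (𝓝 0) ∧
        Tendsto (fun t => ‖π t a 1 0 * (cfc f (u t) - f 1 • (1 : MB))‖) atTop (𝓝 0)) := by
  obtain ⟨hcont, -, hlin, -⟩ := hπ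
  have entry_cont : ∀ a i j, ContinuousOn (fun t => π t a i j) (Set.Ici 1) := fun a i j =>
    (continuous_id.matrix_elem i j).comp_continuousOn (hcont a)
  have entry_equi : ∀ i j a, ∀ ε > 0, ∀ᶠ a' in 𝓝 a, ∀ t : ℝ, 1 ≤ t →
      ‖π t a i j - π t a' i j‖ ≤ ε := fun i j a ε hε => by
    filter_upwards [Metric.equicontinuousAt_iff_right.1 (hπ_equi a) ε hε] with a' ha' t ht
    have := ha' ⟨t, ht⟩
    rw [dist_eq_norm] at this
    exact (Matrix.norm_entry_le_entrywise_sup_norm (π t a - π t a')).trans this.le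
  have entry_zero : ∀ i j, Tendsto (fun t => π t 0 i j) atTop (𝓝 0) := fun i j => by
    refine squeeze_zero_norm (fun t => ?_) (hlin 0 0 1)
    have : π t 0 + (1 : ℂ) • π t 0 - π t (0 + (1 : ℂ) • 0) = π t 0 := by
      rw [one_smul, smul_zero, add_zero, add_sub_cancel_right]
    rw [this]
    exact Matrix.norm_entry_le_entrywise_sup_norm (π t 0)
  have entry_bdd : ∀ i j a, ∃ R : ℝ, ∀ᶠ t in atTop, ‖π t a i j‖ ≤ R := fun i j =>
    exists_eventually_norm_le (entry_equi i j) (entry_zero i j)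
  have : Nonempty (B : Set MB) := ⟨⟨0, B.zero_mem⟩⟩
  let d := TopologicalSpace.denseSeq A
  let b := TopologicalSpace.denseSeq (B : Set MB)
  let y : (ℕ ⊕ ℕ) ⊕ ℕ → ℝ → MB :=
    Sum.elim (Sum.elim (fun k t => π t (d k) 0 1) fun k t => π t (d k) 1 0) fun k _ => b k
  let e : ℕ ≃ (ℕ ⊕ ℕ) ⊕ ℕ := (Denumerable.eqv _).symm
  obtain ⟨u, u_cont, hu, hux, huy⟩ := exists_continuous_quasicentral B
    (fun k t => π t (d k) 0 0) (fun k => y (e k)) (fun k => entry_cont _ _ _)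
    (fun k => by
      rcases e k with (k | k) | k
      exacts [entry_cont _ _ _, entry_cont _ _ _, continuousOn_const])
    (fun k t ht => by
      rcases e k with (k | k) | k
      exacts [(hπ_off t ht _).1, (hπ_off t ht _).2, (b k).2])
  replace huy : ∀ i, Tendsto (fun t => y i t * (u t - 1)) atTop (𝓝 0) := fun i => by
    simpa using huy (e.symm i)
  have norm_u : ∀ t, ‖u t‖ ≤ 1 := fun t => norm_le_one_of_nonneg_of_le_one (hu t).2.1 (hu t).2.2
  have norm_u_sub : ∀ t, ‖u t - 1‖ ≤ 1 := fun t => by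
    rw [norm_sub_rev]; exact norm_one_sub_le_one (hu t).2.1 (hu t).2.2
  have norm_mul_sub : ∀ (t : ℝ) (v w : MB), ‖v * (u t - 1) - w * (u t - 1)‖ ≤ ‖v - w‖ :=
    fun t v w => by
      rw [← sub_mul]
      exact (norm_mul_le _ _).trans (mul_le_of_le_one_right (norm_nonneg _) (norm_u_sub t))
  have unit_B : ∀ x : (B : Set MB), Tendsto (fun t => (x : MB) * (u t - 1)) atTop (𝓝 0) := by
    refine tendsto_zero_of_denseRange (fun x ε hε => ?_) (TopologicalSpace.denseRange_denseSeq _)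
      fun k => huy (.inr k)
    filter_upwards [Metric.ball_mem_nhds x hε] with x' hx' t _
    rw [Metric.mem_ball, dist_comm, Subtype.dist_eq, dist_eq_norm] at hx'
    exact (norm_mul_sub t x x').trans hx'.le
  have unit_off : ∀ i j, (∀ k, Tendsto (fun t => π t (d k) i j * (u t - 1)) atTop (𝓝 0)) →
      ∀ a, Tendsto (fun t => π t a i j * (u t - 1)) atTop (𝓝 0) := fun i j h => by
    refine tendsto_zero_of_denseRange (fun a ε hε => ?_) (TopologicalSpace.denseRange_denseSeq _) h
    filter_upwards [entry_equi i j a ε hε] with a' ha' t ht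
    exact (norm_mul_sub t _ _).trans (ha' t ht)
  have comm : ∀ a, Tendsto (fun t => u t * π t a 0 0 - π t a 0 0 * u t) atTop (𝓝 0) := by
    refine tendsto_zero_of_denseRange (ψ := fun t a => u t * π t a 0 0 - π t a 0 0 * u t)
      (fun a ε hε => ?_) (TopologicalSpace.denseRange_denseSeq _) hux
    filter_upwards [entry_equi 0 0 a (ε / 2) (by positivity)] with a' ha' t ht
    have h := ha' t ht
    set z := π t a 0 0 - π t a' 0 0 with hz
    have : u t * π t a 0 0 - π t a 0 0 * u t - (u t * π t a' 0 0 - π t a' 0 0 * u t)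
        = u t * z - z * u t := by rw [hz]; noncomm_ring
    rw [this]
    have h₁ := (norm_mul_le (u t) z).trans (mul_le_of_le_one_left (norm_nonneg z) (norm_u t))
    have h₂ := (norm_mul_le z (u t)).trans (mul_le_of_le_one_right (norm_nonneg z) (norm_u t))
    linarith [norm_sub_le (u t * z) (z * u t)]
  refine ⟨u, u_cont.continuousOn, fun t _ => hu t, fun x hx => ?_, fun f hf a => ⟨?_, ?_, ?_⟩⟩
  · have lim := (unit_B ⟨x * star x, B.mul_mem_right _ _ hx⟩).norm.sqrt
    rw [norm_zero, Real.sqrt_zero] at lim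
    refine squeeze_zero (fun t => norm_nonneg _) (fun t => Real.le_sqrt_of_sq_le ?_) lim
    have sa : star (u t - 1) = u t - 1 := by
      rw [star_sub, star_one, (IsSelfAdjoint.of_nonneg (hu t).2.1).star_eq]
    have : (u t * x - x) * star (u t * x - x) = (u t - 1) * (x * star x * (u t - 1)) := by
      rw [show u t * x - x = (u t - 1) * x by noncomm_ring, star_mul, sa]; noncomm_ring
    rw [sq, ← CStarRing.norm_self_mul_star, this]
    exact (norm_mul_le _ _).trans (mul_le_of_le_one_left (norm_nonneg _) (norm_u_sub t))
  · obtain ⟨R, hR⟩ := entry_bdd 0 0 a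
    exact tendsto_norm_commutator_cfc hf (.of_forall fun t => (hu t).2) hR (comm a)
  · obtain ⟨R, hR⟩ := entry_bdd 0 1 a
    exact tendsto_norm_mul_cfc_sub hf (.of_forall fun t => (hu t).2) hR
      (unit_off 0 1 (fun k => huy (.inl (.inl k))) a)
  · obtain ⟨R, hR⟩ := entry_bdd 1 0 a
    exact tendsto_norm_mul_cfc_sub hf (.of_forall fun t => (hu t).2) hR
      (unit_off 1 0 (fun k => huy (.inl (.inr k))) a)
end

section
/- Let E be a unital C*-algebra, J ⊆ E a closed two-sided ideal, p₀ ∈ E a projection, and (Q_t)_{t∈[1,∞)} a norm-continuous family of self-adjoint elements of E such that Q_t − p₀ ∈ J for every t and lim_{t→∞} ‖Q_t² − Q_t‖ = 0. Then there exist t₀ ≥ 1 and a norm-continuous family (P_t)_{t∈[t₀,∞)} of projections in E such that lim_{t→∞} ‖P_t − Q_t‖ = 0 and P_t − p₀ ∈ J for all t ≥ t₀. -/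
open Filter Topology

/-- The continuous functional calculus respects congruence modulo a closed two-sided ideal. -/
theorem cfc_sub_cfc_mem_of_sub_mem {E : Type*} [CStarAlgebra E] {J : TwoSidedIdeal E}
    (hJ : IsClosed (J : Set E)) {a b : E} (ha : IsSelfAdjoint a) (hb : IsSelfAdjoint b)
    (hab : a - b ∈ J) {f : ℝ → ℝ} (hf : Continuous f) :
    cfc f a - cfc f b ∈ J := by
  have hcompact : IsCompact (spectrum ℝ a ∪ spectrum ℝ b) :=
    (ContinuousFunctionalCalculus.isCompact_spectrum (R := ℝ) a).union
      (ContinuousFunctionalCalculus.isCompact_spectrum (R := ℝ) b)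
  have : CompactSpace ↑(spectrum ℝ a ∪ spectrum ℝ b) := isCompact_iff_compactSpace.mp hcompact
  have hsa : spectrum ℝ a ⊆ spectrum ℝ a ∪ spectrum ℝ b := Set.subset_union_left
  have hsb : spectrum ℝ b ⊆ spectrum ℝ a ∪ spectrum ℝ b := Set.subset_union_right
  have key (g : C(↑(spectrum ℝ a ∪ spectrum ℝ b), ℝ)) :
      cfcHomSuperset ha hsa g - cfcHomSuperset hb hsb g ∈ J := by
    induction g using ContinuousMap.induction_on_of_compact with
    | const r =>
      have h : ContinuousMap.const ↑(spectrum ℝ a ∪ spectrum ℝ b) r = algebraMap ℝ _ r := rfl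
      simp only [h, AlgHomClass.commutes, sub_self, J.zero_mem]
    | id => simpa only [cfcHomSuperset_id] using hab
    | star_id => simpa only [map_star, cfcHomSuperset_id, ha.star_eq, hb.star_eq] using hab
    | add g h hg hh =>
      simp only [map_add, add_sub_add_comm]
      exact J.add_mem hg hh
    | mul g h hg hh =>
      simp only [map_mul]
      rw [show ∀ x y z w : E, x * y - z * w = x * (y - w) + (x - z) * w by intros; noncomm_ring]
      exact J.add_mem (J.mul_mem_left _ _ hh) (J.mul_mem_right _ _ hg)
    | frequently g hg =>
      have hclosed : IsClosed
          {h | cfcHomSuperset ha hsa h - cfcHomSuperset hb hsb h ∈ J} :=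
        hJ.preimage ((cfcHomSuperset_continuous ha hsa).sub (cfcHomSuperset_continuous hb hsb))
      exact hclosed.mem_of_frequently_of_tendsto hg tendsto_id
  have hcfc := key ⟨fun x ↦ f x, by fun_prop⟩
  rw [cfc_apply f a, cfc_apply f b]
  exact hcfc

/-- A continuous cutoff, equal to `0` on `(-∞, 1/4]` and to `1` on `[3/4, ∞)`. -/
noncomputable def projectionCutoff (x : ℝ) : ℝ := max 0 (min 1 (2 * x - 1 / 2))

theorem continuous_projectionCutoff : Continuous projectionCutoff := by
  unfold projectionCutoff
  fun_prop

theorem projectionCutoff_of_le {x : ℝ} (hx : x ≤ 1 / 4) : projectionCutoff x = 0 :=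
  max_eq_left ((min_le_right _ _).trans (by linarith))

theorem projectionCutoff_of_ge {x : ℝ} (hx : 3 / 4 ≤ x) : projectionCutoff x = 1 := by
  rw [projectionCutoff, min_eq_left (by linarith), max_eq_right zero_le_one]

theorem le_or_ge_of_abs_mul_self_sub_le {x : ℝ} (hx : |x * x - x| ≤ 3 / 16) :
    x ≤ 1 / 4 ∨ 3 / 4 ≤ x := by
  by_contra! h
  nlinarith [neg_le_of_abs_le hx]

theorem projectionCutoff_mul_self {x : ℝ} (hx : |x * x - x| ≤ 3 / 16) :
    projectionCutoff x * projectionCutoff x = projectionCutoff x := by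
  rcases le_or_ge_of_abs_mul_self_sub_le hx with h | h
  · simp [projectionCutoff_of_le h]
  · simp [projectionCutoff_of_ge h]

theorem abs_projectionCutoff_sub_le {x : ℝ} (hx : |x * x - x| ≤ 3 / 16) :
    |projectionCutoff x - x| ≤ 2 * |x * x - x| := by
  have hfactor : |x * x - x| = |x| * |1 - x| := by
    rw [← abs_mul, ← abs_neg]
    ring_nf
  rw [hfactor]
  rcases le_or_ge_of_abs_mul_self_sub_le hx with h | h
  · rw [projectionCutoff_of_le h, zero_sub, abs_neg]
    nlinarith [abs_nonneg x, le_abs_self (1 - x)]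
  · rw [projectionCutoff_of_ge h]
    nlinarith [abs_nonneg (1 - x), le_abs_self x]

section Cutoff

variable {E : Type*} [CStarAlgebra E] {a : E}

theorem abs_mul_self_sub_le_norm (ha : IsSelfAdjoint a) {x : ℝ} (hx : x ∈ spectrum ℝ a) :
    |x * x - x| ≤ ‖a * a - a‖ := by
  have h : cfc (fun y : ℝ ↦ y * y - y) a = a * a - a := by
    rw [cfc_sub (fun y : ℝ ↦ y * y) (fun y ↦ y) a, cfc_mul (fun y : ℝ ↦ y) (fun y ↦ y) a,
      cfc_id' ℝ a]
  rw [← h, ← Real.norm_eq_abs]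
  exact norm_apply_le_norm_cfc (fun y : ℝ ↦ y * y - y) a hx

theorem cfc_projectionCutoff_mul_self (ha : IsSelfAdjoint a) (h : ‖a * a - a‖ ≤ 3 / 16) :
    cfc projectionCutoff a * cfc projectionCutoff a = cfc projectionCutoff a := by
  have hcont := continuous_projectionCutoff.continuousOn (s := spectrum ℝ a)
  rw [← cfc_mul projectionCutoff projectionCutoff a]
  exact cfc_congr fun x hx ↦ projectionCutoff_mul_self ((abs_mul_self_sub_le_norm ha hx).trans h)

theorem norm_cfc_projectionCutoff_sub_le (ha : IsSelfAdjoint a) (h : ‖a * a - a‖ ≤ 3 / 16) :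
    ‖cfc projectionCutoff a - a‖ ≤ 2 * ‖a * a - a‖ := by
  have hcont := continuous_projectionCutoff.continuousOn (s := spectrum ℝ a)
  have hsub : cfc (fun x ↦ projectionCutoff x - x) a = cfc projectionCutoff a - a := by
    rw [cfc_sub projectionCutoff (fun x ↦ x) a, cfc_id' ℝ a]
  rw [← hsub]
  refine norm_cfc_le (by positivity) fun x hx ↦ ?_
  have hle := abs_mul_self_sub_le_norm ha hx
  rw [Real.norm_eq_abs]
  linarith [abs_projectionCutoff_sub_le (hle.trans h)]

theorem cfc_projectionCutoff_of_mul_self (ha : IsSelfAdjoint a) (h : a * a = a) :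
    cfc projectionCutoff a = a := by
  have hle := norm_cfc_projectionCutoff_sub_le ha (by norm_num [h])
  simpa [h, sub_eq_zero] using hle

end Cutoff

/-- Given a norm-continuous family `(Q_t)_{t ≥ 1}` of self-adjoint elements of a unital
C*-algebra `E` with `Q_t - p₀ ∈ J` (a closed two-sided ideal) and `‖Q_t² - Q_t‖ → 0`, there
is, for `t` large, a norm-continuous family of genuine projections `P_t` with
`‖P_t - Q_t‖ → 0` and `P_t - p₀ ∈ J`. -/
theorem statement17 {E : Type*} [CStarAlgebra E]
    (J : TwoSidedIdeal E) (hJ : IsClosed (J : Set E))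
    (p₀ : E) (hp₀_sa : IsSelfAdjoint p₀) (hp₀_idem : p₀ * p₀ = p₀)
    (Q : ℝ → E) (hQ_cont : ContinuousOn Q (Set.Ici 1))
    (hQ_sa : ∀ t ∈ Set.Ici (1 : ℝ), IsSelfAdjoint (Q t))
    (hQ_J : ∀ t ∈ Set.Ici (1 : ℝ), Q t - p₀ ∈ J)
    (hQ_idem : Tendsto (fun t => ‖Q t * Q t - Q t‖) atTop (𝓝 0)) :
    ∃ t₀ : ℝ, 1 ≤ t₀ ∧ ∃ P : ℝ → E,
      ContinuousOn P (Set.Ici t₀) ∧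
      (∀ t ∈ Set.Ici t₀, IsSelfAdjoint (P t) ∧ P t * P t = P t ∧ P t - p₀ ∈ J) ∧
      Tendsto (fun t => ‖P t - Q t‖) atTop (𝓝 0) := by
  have hsmall : ∀ᶠ t in atTop, ‖Q t * Q t - Q t‖ ≤ 3 / 16 :=
    hQ_idem.eventually_le_const (by norm_num)
  obtain ⟨t₁, ht₁⟩ := eventually_atTop.mp hsmall
  refine ⟨max 1 t₁, le_max_left _ _, fun t ↦ cfc projectionCutoff (Q t), ?_, ?_, ?_⟩
  · have hcont : ContinuousOn (fun t ↦ cfc projectionCutoff (Q t)) (Set.Ici 1) :=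
      ContinuousOn.cfc_of_mem_nhdsSet (s := Set.univ) projectionCutoff univ_mem hQ_cont hQ_sa
        continuous_projectionCutoff.continuousOn
    exact hcont.mono (Set.Ici_subset_Ici.mpr (le_max_left _ _))
  · intro t ht
    rw [Set.mem_Ici, max_le_iff] at ht
    have ht_one : t ∈ Set.Ici (1 : ℝ) := ht.1
    have hmem := cfc_sub_cfc_mem_of_sub_mem hJ (hQ_sa t ht_one) hp₀_sa (hQ_J t ht_one)
      continuous_projectionCutoff
    rw [cfc_projectionCutoff_of_mul_self hp₀_sa hp₀_idem] at hmem
    exact ⟨cfc_predicate _ _,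
      cfc_projectionCutoff_mul_self (hQ_sa t ht_one) (ht₁ t ht.2), hmem⟩
  · refine squeeze_zero' (Eventually.of_forall fun t ↦ norm_nonneg _) ?_
      (by simpa using hQ_idem.const_mul 2)
    filter_upwards [hsmall, eventually_ge_atTop 1] with t ht ht_one
    exact norm_cfc_projectionCutoff_sub_le (hQ_sa t ht_one) ht
end

section
/- For each integer m ≥ 1 and each i ∈ ℤ define α_i(m) = 1 if i ≥ 0, α_i(m) = 1 + i/m if −m < i < 0, and α_i(m) = 0 if i ≤ −m; for real t ∈ [m, m+1] set α_i(t) = (m+1−t)α_i(m) + (t−m)α_i(m+1). Let H = ℓ²(ℤ, ℂ²) and for each t ∈ [1,∞) let U_t be the bounded operator on H which acts on the i-th fibre ℂ² by the matrix [[√(α_i(t)), −√(1−α_i(t))], [√(1−α_i(t)), √(α_i(t))]]. Let W be the bounded operator on H acting on each fibre as (Wξ)(i) = ξ(i−1) (the bilateral shift amplified to ℂ²-valued sequences). Then each U_t is unitary, t ↦ U_t is norm-continuous, and lim_{t→∞} ‖U_t W − W U_t‖ = 0. -/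
open Filter Topology

/-- `α_i(m)` for integer `m ≥ 1`. -/
noncomputable def alphaInt (i : ℤ) (m : ℕ) : ℝ :=
  if 0 ≤ i then 1 else if -(m : ℤ) < i then 1 + (i : ℝ) / (m : ℝ) else 0

/-- The piecewise-linear interpolation `α_i(t)`: for `t ∈ [m, m+1]`,
`α_i(t) = (m+1-t)·α_i(m) + (t-m)·α_i(m+1)`. -/
noncomputable def alphaFun (i : ℤ) (t : ℝ) : ℝ :=
  ((⌊t⌋₊ : ℝ) + 1 - t) * alphaInt i ⌊t⌋₊ + (t - (⌊t⌋₊ : ℝ)) * alphaInt i (⌊t⌋₊ + 1)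

/-- The Hilbert space `ℓ²(ℤ, ℂ²)`. -/
local notation "H" => lp (fun _ : ℤ => EuclideanSpace ℂ (Fin 2)) 2

lemma alphaInt_eq_clamp (i : ℤ) {m : ℕ} (hm : 1 ≤ m) :
    alphaInt i m = max 0 (min 1 (1 + (i : ℝ) / m)) := by
  have hm' : (0 : ℝ) < m := by exact_mod_cast hm
  unfold alphaInt
  split_ifs with h h'
  · have : (0 : ℝ) ≤ (i : ℝ) / m := div_nonneg (by exact_mod_cast h) hm'.le
    rw [min_eq_left (by linarith), max_eq_right zero_le_one]
  · have h1 : (i : ℝ) / m ≤ 0 :=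
      div_nonpos_of_nonpos_of_nonneg (by exact_mod_cast (not_le.1 h).le) hm'.le
    have h2 : -1 ≤ (i : ℝ) / m := by
      rw [le_div_iff₀ hm']
      have : (-(m : ℝ)) < i := by exact_mod_cast h'
      linarith
    rw [min_eq_right (by linarith), max_eq_right (by linarith)]
  · have h2 : (i : ℝ) / m ≤ -1 := by
      rw [div_le_iff₀ hm']
      have : (i : ℝ) ≤ -(m : ℝ) := by exact_mod_cast not_lt.1 h'
      linarith
    rw [min_eq_right (by linarith), max_eq_left (by linarith)]

lemma alphaInt_mem_Icc (i : ℤ) {m : ℕ} (hm : 1 ≤ m) : alphaInt i m ∈ Set.Icc (0 : ℝ) 1 := by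
  rw [alphaInt_eq_clamp i hm]
  exact ⟨le_max_left _ _, max_le zero_le_one (min_le_left _ _)⟩

lemma abs_alphaInt_sub_pred_le (i : ℤ) {m : ℕ} (hm : 1 ≤ m) :
    |alphaInt i m - alphaInt (i - 1) m| ≤ 1 / m := by
  rw [alphaInt_eq_clamp i hm, alphaInt_eq_clamp (i - 1) hm]
  have hm' : (0 : ℝ) < 1 / m := by
    have : (0 : ℝ) < m := by exact_mod_cast hm
    positivity
  have h : (((i - 1 : ℤ) : ℝ)) / m = (i : ℝ) / m - 1 / m := by push_cast; ring
  rw [h]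
  grind

lemma alphaFun_mem_Icc (i : ℤ) {t : ℝ} (ht : 1 ≤ t) : alphaFun i t ∈ Set.Icc (0 : ℝ) 1 := by
  have hm : 1 ≤ ⌊t⌋₊ := Nat.one_le_floor_iff _ |>.2 ht
  have hl := Nat.floor_le (zero_le_one.trans ht)
  have hu := Nat.lt_floor_add_one t
  exact convex_Icc (0 : ℝ) 1 (alphaInt_mem_Icc i hm) (alphaInt_mem_Icc i (Nat.le_add_left 1 _))
    (a := (⌊t⌋₊ : ℝ) + 1 - t) (b := t - ⌊t⌋₊) (by linarith) (by linarith) (by ring)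

lemma abs_alphaFun_sub_pred_le (i : ℤ) {t : ℝ} (ht : 1 ≤ t) :
    |alphaFun i t - alphaFun (i - 1) t| ≤ 1 / (⌊t⌋₊ : ℝ) := by
  have hm : 1 ≤ ⌊t⌋₊ := Nat.one_le_floor_iff _ |>.2 ht
  have hl := Nat.floor_le (zero_le_one.trans ht)
  have hu := Nat.lt_floor_add_one t
  have h1 := abs_le.1 (abs_alphaInt_sub_pred_le i hm)
  have h2 := abs_le.1 (abs_alphaInt_sub_pred_le i (m := ⌊t⌋₊ + 1) (by omega))
  have hm' : (0 : ℝ) < (⌊t⌋₊ : ℝ) := by exact_mod_cast hm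
  have h3 : 1 / ((⌊t⌋₊ + 1 : ℕ) : ℝ) ≤ 1 / (⌊t⌋₊ : ℝ) := by
    push_cast
    gcongr
    linarith
  rw [← Set.mem_Icc] at h1
  have h2' : alphaInt i (⌊t⌋₊ + 1) - alphaInt (i - 1) (⌊t⌋₊ + 1) ∈
      Set.Icc (-(1 / (⌊t⌋₊ : ℝ))) (1 / (⌊t⌋₊ : ℝ)) :=
    ⟨by linarith [h2.1], by linarith [h2.2]⟩
  have h4 := convex_Icc _ _ h1 h2' (a := (⌊t⌋₊ : ℝ) + 1 - t) (b := t - ⌊t⌋₊)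
    (by linarith) (by linarith) (by ring)
  rw [abs_le, ← Set.mem_Icc]
  convert h4 using 1
  simp only [alphaFun, smul_eq_mul]
  ring

lemma abs_alphaFun_sub_le_of_le (i : ℤ) {s t : ℝ} (hs : 1 ≤ s) (hst : s ≤ t) (h : t < s + 1) :
    |alphaFun i t - alphaFun i s| ≤ t - s := by
  have hm : 1 ≤ ⌊s⌋₊ := Nat.one_le_floor_iff _ |>.2 hs
  have hl := Nat.floor_le (zero_le_one.trans hs)
  have hu := Nat.lt_floor_add_one s
  have hl' := Nat.floor_le (zero_le_one.trans (hs.trans hst))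
  have hu' := Nat.lt_floor_add_one t
  obtain ⟨ha, ha'⟩ := alphaInt_mem_Icc i hm
  obtain ⟨hb, hb'⟩ := alphaInt_mem_Icc i (m := ⌊s⌋₊ + 1) (by omega)
  obtain ⟨hc, hc'⟩ := alphaInt_mem_Icc i (m := ⌊s⌋₊ + 1 + 1) (by omega)
  have hle : ⌊s⌋₊ ≤ ⌊t⌋₊ := Nat.floor_mono hst
  have hlt : ⌊t⌋₊ < ⌊s⌋₊ + 2 := by
    have : (⌊t⌋₊ : ℝ) < (⌊s⌋₊ + 2 : ℕ) := by push_cast; linarith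
    exact_mod_cast this
  obtain he | he : ⌊t⌋₊ = ⌊s⌋₊ ∨ ⌊t⌋₊ = ⌊s⌋₊ + 1 := by omega
  · simp only [alphaFun, he]
    rw [abs_le]
    constructor <;> nlinarith
  · simp only [alphaFun, he]
    rw [he] at hl'
    push_cast at hl' ⊢
    rw [abs_le]
    constructor <;> nlinarith

lemma abs_alphaFun_sub_le (i : ℤ) {s t : ℝ} (hs : 1 ≤ s) (ht : 1 ≤ t) (h : |t - s| < 1) :
    |alphaFun i t - alphaFun i s| ≤ |t - s| := by
  rw [abs_lt] at h
  rcases le_total s t with hst | hst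
  · rw [abs_of_nonneg (sub_nonneg.2 hst)]
    exact abs_alphaFun_sub_le_of_le i hs hst (by linarith)
  · rw [abs_sub_comm, abs_sub_comm t, abs_of_nonneg (sub_nonneg.2 hst)]
    exact abs_alphaFun_sub_le_of_le i ht hst (by linarith)

lemma sq_sqrt_sub_sqrt_le {x y : ℝ} (hx : 0 ≤ x) (hy : 0 ≤ y) : (√x - √y) ^ 2 ≤ |x - y| := by
  have h : |x - y| = |√x - √y| * (√x + √y) := by
    rw [← abs_of_nonneg (add_nonneg (Real.sqrt_nonneg x) (Real.sqrt_nonneg y)), ← abs_mul]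
    congr 1
    nlinarith [Real.sq_sqrt hx, Real.sq_sqrt hy]
  rw [h, ← sq_abs, sq]
  gcongr
  rw [abs_le]
  constructor <;> linarith [Real.sqrt_nonneg x, Real.sqrt_nonneg y]

/-- A real multiple of a rotation scales the Euclidean norm on `ℂ²`. -/
lemma norm_sq_eq_of_rotation {v w : EuclideanSpace ℂ (Fin 2)} (a b : ℝ)
    (h0 : w 0 = a * v 0 - b * v 1) (h1 : w 1 = b * v 0 + a * v 1) :
    ‖w‖ ^ 2 = (a ^ 2 + b ^ 2) * ‖v‖ ^ 2 := by
  simp only [EuclideanSpace.norm_sq_eq, Fin.sum_univ_two, h0, h1, ← Complex.normSq_eq_norm_sq,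
    Complex.normSq_apply, Complex.add_re, Complex.add_im, Complex.sub_re, Complex.sub_im,
    Complex.re_ofReal_mul, Complex.im_ofReal_mul]
  ring

lemma hasSum_norm_sq (ξ : H) : HasSum (fun i => ‖ξ i‖ ^ 2) (‖ξ‖ ^ 2) := by
  simpa using lp.hasSum_norm (p := 2) (by norm_num) ξ

/-- An operator on `ℓ²` is bounded by `C` if it is fibrewise bounded by `C`, up to a permutation
of the fibres. -/
lemma opNorm_le_of_fibre_le (T : H →L[ℂ] H) (e : ℤ ≃ ℤ) {C : ℝ} (hC : 0 ≤ C)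
    (h : ∀ (ξ : H) (i : ℤ), ‖T ξ i‖ ^ 2 ≤ C ^ 2 * ‖ξ (e i)‖ ^ 2) : ‖T‖ ≤ C := by
  refine T.opNorm_le_bound hC fun ξ => ?_
  rw [← pow_le_pow_iff_left₀ (norm_nonneg _) (by positivity) two_ne_zero, mul_pow]
  exact hasSum_le (h ξ) (hasSum_norm_sq (T ξ))
    ((e.hasSum_iff.2 (hasSum_norm_sq ξ)).mul_left (C ^ 2))

lemma mem_unitary_of_norm_map_of_surjective {E : Type*} [NormedAddCommGroup E]
    [InnerProductSpace ℂ E] [CompleteSpace E] (T : E →L[ℂ] E) (hn : ∀ x, ‖T x‖ = ‖x‖)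
    (hs : Function.Surjective T) : T ∈ unitary (E →L[ℂ] E) := by
  have h1 : star T * T = 1 := T.norm_map_iff_adjoint_comp_self.1 hn
  refine Unitary.mem_iff.2 ⟨h1, ?_⟩
  ext y
  obtain ⟨x, rfl⟩ := hs y
  have : star T (T x) = x := congrArg (fun S : E →L[ℂ] E => S x) h1
  simp [this]

/-- An operator acting fibrewise by rotation matrices is unitary. -/
lemma mem_unitary_of_rotation (T : H →L[ℂ] H) (a b : ℤ → ℝ) (hab : ∀ i, a i ^ 2 + b i ^ 2 = 1)
    (hT : ∀ (ξ : H) (i : ℤ), T ξ i 0 = a i * ξ i 0 - b i * ξ i 1 ∧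
      T ξ i 1 = b i * ξ i 0 + a i * ξ i 1) : T ∈ unitary (H →L[ℂ] H) := by
  refine mem_unitary_of_norm_map_of_surjective T (fun ξ => ?_) fun η => ?_
  · rw [← pow_left_inj₀ (norm_nonneg _) (norm_nonneg _) two_ne_zero]
    refine (hasSum_norm_sq (T ξ)).unique ?_
    convert hasSum_norm_sq ξ using 2 with i
    rw [norm_sq_eq_of_rotation _ _ (hT ξ i).1 (hT ξ i).2, hab, one_mul]
  · let f : ℤ → EuclideanSpace ℂ (Fin 2) := fun i =>
      !₂[a i * η i 0 + b i * η i 1, -b i * η i 0 + a i * η i 1]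
    have hf : ∀ i, ‖f i‖ ^ 2 = ‖η i‖ ^ 2 := fun i => by
      rw [norm_sq_eq_of_rotation (w := f i) (v := η i) (a i) (-b i) (by simp [f]) (by simp [f]),
        neg_sq, hab, one_mul]
    have hmem : Memℓp f 2 := by
      refine memℓp_gen ?_
      simpa [hf] using (hasSum_norm_sq η).summable
    refine ⟨⟨f, hmem⟩, ?_⟩
    ext i j
    have hab' : (a i : ℂ) ^ 2 + (b i : ℂ) ^ 2 = 1 := by exact_mod_cast hab i
    fin_cases j
    · refine (hT _ i).1.trans ?_
      simp [f]
      linear_combination (η i 0) * hab'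
    · refine (hT _ i).2.trans ?_
      simp [f]
      linear_combination (η i 1) * hab'

/-- On `H = ℓ²(ℤ, ℂ²)`, the operators `U_t` acting fibrewise by the rotation-type matrices
`[[√α_i(t), -√(1-α_i(t))], [√(1-α_i(t)), √α_i(t)]]` are unitary, depend norm-continuously
on `t`, and asymptotically commute with the (amplified) bilateral shift `W`. -/
theorem statement18
    (U : ℝ → (lp (fun _ : ℤ => EuclideanSpace ℂ (Fin 2)) 2) →L[ℂ]
      (lp (fun _ : ℤ => EuclideanSpace ℂ (Fin 2)) 2))
    (W : (lp (fun _ : ℤ => EuclideanSpace ℂ (Fin 2)) 2) →L[ℂ]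
      (lp (fun _ : ℤ => EuclideanSpace ℂ (Fin 2)) 2))
    (hW : ∀ (ξ : lp (fun _ : ℤ => EuclideanSpace ℂ (Fin 2)) 2) (i : ℤ),
      (W ξ : ∀ _ : ℤ, EuclideanSpace ℂ (Fin 2)) i = (ξ : ∀ _ : ℤ, EuclideanSpace ℂ (Fin 2)) (i - 1))
    (hU : ∀ t ∈ Set.Ici (1 : ℝ), ∀ (ξ : lp (fun _ : ℤ => EuclideanSpace ℂ (Fin 2)) 2) (i : ℤ),
      (U t ξ : ∀ _ : ℤ, EuclideanSpace ℂ (Fin 2)) i 0 =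
        (Real.sqrt (alphaFun i t) : ℂ) * (ξ : ∀ _ : ℤ, EuclideanSpace ℂ (Fin 2)) i 0 -
        (Real.sqrt (1 - alphaFun i t) : ℂ) * (ξ : ∀ _ : ℤ, EuclideanSpace ℂ (Fin 2)) i 1 ∧
      (U t ξ : ∀ _ : ℤ, EuclideanSpace ℂ (Fin 2)) i 1 =
        (Real.sqrt (1 - alphaFun i t) : ℂ) * (ξ : ∀ _ : ℤ, EuclideanSpace ℂ (Fin 2)) i 0 +
        (Real.sqrt (alphaFun i t) : ℂ) * (ξ : ∀ _ : ℤ, EuclideanSpace ℂ (Fin 2)) i 1) :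
    (∀ t ∈ Set.Ici (1 : ℝ), U t ∈ unitary ((lp (fun _ : ℤ => EuclideanSpace ℂ (Fin 2)) 2) →L[ℂ]
      (lp (fun _ : ℤ => EuclideanSpace ℂ (Fin 2)) 2))) ∧
    ContinuousOn U (Set.Ici 1) ∧
    Tendsto (fun t => ‖U t * W - W * U t‖) atTop (𝓝 0) := by
  have hsq : ∀ x y : ℝ, x ∈ Set.Icc (0 : ℝ) 1 → y ∈ Set.Icc (0 : ℝ) 1 →
      (√x - √y) ^ 2 + (√(1 - x) - √(1 - y)) ^ 2 ≤ 2 * |x - y| := fun x y hx hy => by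
    have h1 := sq_sqrt_sub_sqrt_le hx.1 hy.1
    have h2 := sq_sqrt_sub_sqrt_le (sub_nonneg.2 hx.2) (sub_nonneg.2 hy.2)
    rw [sub_sub_sub_cancel_left, abs_sub_comm] at h2
    linarith
  have hcont : ∀ s ∈ Set.Ici (1 : ℝ), ∀ t ∈ Set.Ici (1 : ℝ), |t - s| < 1 →
      ‖U t - U s‖ ≤ √(2 * |t - s|) := fun s hs t ht hst => by
    refine opNorm_le_of_fibre_le _ (Equiv.refl ℤ) (Real.sqrt_nonneg _) fun ξ i => ?_
    rw [norm_sq_eq_of_rotation (v := ξ i) (√(alphaFun i t) - √(alphaFun i s))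
      (√(1 - alphaFun i t) - √(1 - alphaFun i s)), Real.sq_sqrt (by positivity)]
    · refine mul_le_mul_of_nonneg_right ?_ (sq_nonneg _)
      have := hsq _ _ (alphaFun_mem_Icc i ht) (alphaFun_mem_Icc i hs)
      linarith [abs_alphaFun_sub_le i hs ht hst]
    · change U t ξ i 0 - U s ξ i 0 = _
      rw [(hU t ht ξ i).1, (hU s hs ξ i).1]
      push_cast
      ring
    · change U t ξ i 1 - U s ξ i 1 = _
      rw [(hU t ht ξ i).2, (hU s hs ξ i).2]
      push_cast
      ring
  have hcomm : ∀ t ∈ Set.Ici (1 : ℝ),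
      ‖U t * W - W * U t‖ ≤ √(2 * (1 / (⌊t⌋₊ : ℝ))) := fun t ht => by
    refine opNorm_le_of_fibre_le _ (Equiv.subRight 1) (Real.sqrt_nonneg _) fun ξ i => ?_
    rw [norm_sq_eq_of_rotation (v := ξ (i - 1)) (√(alphaFun i t) - √(alphaFun (i - 1) t))
      (√(1 - alphaFun i t) - √(1 - alphaFun (i - 1) t)), Real.sq_sqrt (by positivity)]
    · refine mul_le_mul_of_nonneg_right ?_ (sq_nonneg _)
      have := hsq _ _ (alphaFun_mem_Icc i ht) (alphaFun_mem_Icc (i - 1) ht)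
      linarith [abs_alphaFun_sub_pred_le i ht]
    · change U t (W ξ) i 0 - W (U t ξ) i 0 = _
      rw [hW, (hU t ht (W ξ) i).1, (hU t ht ξ (i - 1)).1, hW]
      push_cast
      ring
    · change U t (W ξ) i 1 - W (U t ξ) i 1 = _
      rw [hW, (hU t ht (W ξ) i).2, (hU t ht ξ (i - 1)).2, hW]
      push_cast
      ring
  refine ⟨fun t ht => ?_, fun s hs => ?_, ?_⟩
  · refine mem_unitary_of_rotation _ _ _ (fun i => ?_) (hU t ht)
    rw [Real.sq_sqrt (alphaFun_mem_Icc i ht).1, Real.sq_sqrt (sub_nonneg.2 (alphaFun_mem_Icc i ht).2)]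
    ring
  · rw [ContinuousWithinAt, tendsto_iff_norm_sub_tendsto_zero]
    have hlim : Tendsto (fun t : ℝ => √(2 * |t - s|)) (𝓝[Set.Ici 1] s) (𝓝 0) := by
      have : Continuous fun t : ℝ => √(2 * |t - s|) := by fun_prop
      simpa using (this.tendsto s).mono_left nhdsWithin_le_nhds
    refine squeeze_zero' (.of_forall fun _ => norm_nonneg _) ?_ hlim
    filter_upwards [self_mem_nhdsWithin, nhdsWithin_le_nhds (Metric.ball_mem_nhds s one_pos)]
      with t ht hst
    exact hcont s hs t ht hst
  · have hlim : Tendsto (fun t : ℝ => √(2 * (1 / (⌊t⌋₊ : ℝ)))) atTop (𝓝 0) := by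
      have := ((tendsto_one_div_atTop_nhds_zero_nat (𝕜 := ℝ)).comp
        (tendsto_nat_floor_atTop (α := ℝ))).const_mul 2
      simpa using this.sqrt
    refine squeeze_zero' (.of_forall fun _ => norm_nonneg _) ?_ hlim
    filter_upwards [eventually_ge_atTop 1] with t ht
    exact hcomm t ht
end
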